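/- Let f : ℝ^d → ℝ be convex and differentiable attaining its minimum f* at x*, and let h : ℝ^d → ℝ be convex and differentiable. Let α, β : (0, ∞) → ℝ be continuously differentiable with β̇_t ≤ 2α̇_t + e^{α_t} for all t, and let X : (0, ∞) → ℝ^d be twice continuously differentiable satisfying the Bregman flow: with Z_t = X_t + e^{−α_t} Ẋ_t, the curve satisfies d/dt ∇h(Z_t) = −e^{β_t − α_t} ∇f(X_t). Then for all t ≥ t_0 > 0, f(X_t) − f* ≤ E_{t_0} · e^{2α_t − β_t}, where E_t = e^{β_t − 2α_t}(f(X_t) − f*) + D_h(x*, Z_t). -/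

import Mathlib

open scoped RealInnerProductSpace
open Real Set

noncomputable section

/-- Bregman divergence `D_h(y, x) = h(y) − h(x) − ⟨∇h(x), y − x⟩`. -/
def breg (d : ℕ) (h : EuclideanSpace ℝ (Fin d) → ℝ)
    (y x : EuclideanSpace ℝ (Fin d)) : ℝ :=
  h y - h x - ⟪gradient h x, y - x⟫

/-- First-order convexity inequality. -/
theorem ConvexOn.inner_gradient_le {E : Type*} [NormedAddCommGroup E]
    [InnerProductSpace ℝ E] [CompleteSpace E] {f : E → ℝ} (hconv : ConvexOn ℝ Set.univ f) {x : E}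
    (hf : DifferentiableAt ℝ f x) (y : E) : ⟪gradient f x, y - x⟫ ≤ f y - f x := by
  have hline : ConvexOn ℝ Set.univ (f ∘ AffineMap.lineMap (k := ℝ) x y) :=
    hconv.comp_affineMap (AffineMap.lineMap x y)
  have hderiv : HasDerivAt (f ∘ AffineMap.lineMap (k := ℝ) x y) ⟪gradient f x, y - x⟫ 0 := by
    have hgrad : HasFDerivAt f (InnerProductSpace.toDual ℝ E (gradient f x))
        (AffineMap.lineMap x y (0 : ℝ)) := by
      simpa using hf.hasGradientAt.hasFDerivAt
    simpa using hgrad.comp_hasDerivAt (0 : ℝ) AffineMap.hasDerivAt_lineMap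
  simpa [slope_def_field] using
    hline.le_slope_of_hasDerivAt (mem_univ 0) (mem_univ 1) zero_lt_one hderiv

theorem HasGradientAt.comp_hasDerivAt {E : Type*} [NormedAddCommGroup E]
    [InnerProductSpace ℝ E] [CompleteSpace E] {f : E → ℝ} {g : E} {X : ℝ → E} {X' : E} {t : ℝ}
    (hf : HasGradientAt f g (X t)) (hX : HasDerivAt X X' t) :
    HasDerivAt (fun s => f (X s)) ⟪g, X'⟫ t := by
  simpa [Function.comp_def] using hf.hasFDerivAt.comp_hasDerivAt t hX

theorem breg_nonneg {d : ℕ} {h : EuclideanSpace ℝ (Fin d) → ℝ} (hconv : ConvexOn ℝ Set.univ h)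
    (y : EuclideanSpace ℝ (Fin d)) {x : EuclideanSpace ℝ (Fin d)} (hh : DifferentiableAt ℝ h x) :
    0 ≤ breg d h y x := by
  have := hconv.inner_gradient_le hh y
  unfold breg
  linarith

/-- Along a differentiable curve `Z` for which `∇h(Z)` is differentiable with derivative `G'`,
the derivative of `D_h(y, Z)` is `-⟨G', y - Z⟩`. -/
theorem hasDerivAt_breg {d : ℕ} {h : EuclideanSpace ℝ (Fin d) → ℝ}
    {Z : ℝ → EuclideanSpace ℝ (Fin d)} {Z' G' : EuclideanSpace ℝ (Fin d)} {t : ℝ}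
    (hh : DifferentiableAt ℝ h (Z t)) (hZ : HasDerivAt Z Z' t)
    (hG : HasDerivAt (fun s => gradient h (Z s)) G' t) (y : EuclideanSpace ℝ (Fin d)) :
    HasDerivAt (fun s => breg d h y (Z s)) (-⟪G', y - Z t⟫) t := by
  have hhZ := hh.hasGradientAt.comp_hasDerivAt hZ
  refine ((hhZ.const_sub (h y)).sub (hG.inner ℝ (hZ.const_sub y))).congr_deriv ?_
  rw [inner_neg_right]
  ring

theorem bregman_flow_rate
    (d : ℕ)
    (f h : EuclideanSpace ℝ (Fin d) → ℝ)
    (hconv : ConvexOn ℝ Set.univ f) (hf : Differentiable ℝ f)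
    (hhconv : ConvexOn ℝ Set.univ h) (hh : Differentiable ℝ h)
    (xstar : EuclideanSpace ℝ (Fin d)) (hmin : ∀ x, f xstar ≤ f x)
    (α β α' β' : ℝ → ℝ)
    (hα : ∀ t ∈ Set.Ioi (0 : ℝ), HasDerivAt α (α' t) t)
    (hβ : ∀ t ∈ Set.Ioi (0 : ℝ), HasDerivAt β (β' t) t)
    (hα'cont : ContinuousOn α' (Set.Ioi 0)) (hβ'cont : ContinuousOn β' (Set.Ioi 0))
    (hscaling : ∀ t ∈ Set.Ioi (0 : ℝ), β' t ≤ 2 * α' t + Real.exp (α t))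
    (X X' X'' : ℝ → EuclideanSpace ℝ (Fin d))
    (hX : ∀ t ∈ Set.Ioi (0 : ℝ), HasDerivAt X (X' t) t)
    (hX' : ∀ t ∈ Set.Ioi (0 : ℝ), HasDerivAt X' (X'' t) t)
    (hflow : ∀ t ∈ Set.Ioi (0 : ℝ),
      HasDerivAt (fun s => gradient h (X s + Real.exp (-α s) • X' s))
        (-Real.exp (β t - α t) • gradient f (X t)) t) :
    ∀ t0 t : ℝ, 0 < t0 → t0 ≤ t →
      f (X t) - f xstar ≤
        (Real.exp (β t0 - 2 * α t0) * (f (X t0) - f xstar) +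
          breg d h xstar (X t0 + Real.exp (-α t0) • X' t0)) *
        Real.exp (2 * α t - β t) := by
  intro t0 t ht0 ht
  set Z : ℝ → EuclideanSpace ℝ (Fin d) := fun s => X s + Real.exp (-α s) • X' s with hZdef
  set E : ℝ → ℝ := fun s =>
    Real.exp (β s - 2 * α s) * (f (X s) - f xstar) + breg d h xstar (Z s)
  have hE : ∀ s ∈ Set.Ioi (0 : ℝ), HasDerivAt E
      (Real.exp (β s - 2 * α s) * (β' s - 2 * α' s) * (f (X s) - f xstar) +
        Real.exp (β s - 2 * α s) * ⟪gradient f (X s), X' s⟫ +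
        Real.exp (β s - α s) * ⟪gradient f (X s), xstar - Z s⟫) s := by
    intro s hs
    have hZ := (hX s hs).add ((hα s hs).neg.exp.smul (hX' s hs))
    have hweight := ((hβ s hs).sub ((hα s hs).const_mul 2)).exp
    have hgap := ((hf (X s)).hasGradientAt.comp_hasDerivAt (hX s hs)).sub_const (f xstar)
    have hbreg := hasDerivAt_breg (hh (Z s)) hZ (hflow s hs) xstar
    refine ((hweight.mul hgap).add hbreg).congr_deriv ?_
    simp only [Pi.sub_apply, real_inner_smul_left, hZdef]
    simp
  have hE_nonpos : ∀ s ∈ Set.Ioi (0 : ℝ),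
      Real.exp (β s - 2 * α s) * (β' s - 2 * α' s) * (f (X s) - f xstar) +
        Real.exp (β s - 2 * α s) * ⟪gradient f (X s), X' s⟫ +
        Real.exp (β s - α s) * ⟪gradient f (X s), xstar - Z s⟫ ≤ 0 := by
    intro s hs
    have hexp : Real.exp (β s - α s) = Real.exp (β s - 2 * α s) * Real.exp (α s) := by
      rw [← Real.exp_add]; ring_nf
    have hinv : Real.exp (α s) * Real.exp (-α s) = 1 := by
      rw [← Real.exp_add]; simp
    have hinner : ⟪gradient f (X s), xstar - Z s⟫ =
        ⟪gradient f (X s), xstar - X s⟫ - Real.exp (-α s) * ⟪gradient f (X s), X' s⟫ := by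
      rw [← real_inner_smul_right, ← inner_sub_right, sub_sub]
    have hsubgrad := hconv.inner_gradient_le (hf (X s)) xstar
    have hbracket : (β' s - 2 * α' s) * (f (X s) - f xstar) +
        Real.exp (α s) * ⟪gradient f (X s), xstar - X s⟫ ≤ 0 := by
      nlinarith [mul_le_mul_of_nonneg_left hsubgrad (Real.exp_pos (α s)).le,
        mul_nonneg (sub_nonneg.2 (hscaling s hs)) (sub_nonneg.2 (hmin (X s)))]
    calc
      _ = Real.exp (β s - 2 * α s) * ((β' s - 2 * α' s) * (f (X s) - f xstar) +
          Real.exp (α s) * ⟪gradient f (X s), xstar - X s⟫) := by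
        rw [hexp, hinner]
        linear_combination
          (-Real.exp (β s - 2 * α s) * ⟪gradient f (X s), X' s⟫) * hinv
      _ ≤ 0 := mul_nonpos_of_nonneg_of_nonpos (Real.exp_pos _).le hbracket
  have hanti : AntitoneOn E (Set.Ioi 0) :=
    antitoneOn_of_hasDerivWithinAt_nonpos (convex_Ioi 0)
      (fun s hs => (hE s hs).continuousAt.continuousWithinAt)
      (fun s hs => (hE s (interior_subset hs)).hasDerivWithinAt)
      (fun s hs => hE_nonpos s (interior_subset hs))
  have hle : E t ≤ E t0 := hanti ht0 (ht0.trans_le ht) ht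
  have hbreg := breg_nonneg hhconv xstar (hh (Z t))
  have hcancel : Real.exp (β t - 2 * α t) * Real.exp (2 * α t - β t) = 1 := by
    rw [← Real.exp_add]; simp
  calc
    f (X t) - f xstar
        = Real.exp (β t - 2 * α t) * (f (X t) - f xstar) * Real.exp (2 * α t - β t) := by
      linear_combination (-(f (X t) - f xstar)) * hcancel
    _ ≤ E t0 * Real.exp (2 * α t - β t) := by
      gcongr
      exact (le_add_of_nonneg_right hbreg).trans hle
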